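/- Let a > 0 and c ∈ [1/2, 1]. Then the function z ↦ (Ψ(a,c,z))² / Ψ(2a,c,z) is strictly decreasing on (0,∞). -/

import Mathlib

open MeasureTheory Set

/-- The confluent hypergeometric function of the second kind (Tricomi's integral). -/
noncomputable def Psi (a c z : ℝ) : ℝ :=
  (1 / Real.Gamma a) * ∫ t in Ioi (0 : ℝ), Real.exp (-z * t) * t ^ (a - 1) * (1 + t) ^ (c - a - 1)

/-- Powers of `1 + t` are dominated by exponentials of arbitrarily small rate. -/
lemma exists_one_add_rpow_le_mul_exp (p : ℝ) {ε : ℝ} (hε : 0 < ε) :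
    ∃ C : ℝ, ∀ t : ℝ, 0 < t → (1 + t) ^ p ≤ C * Real.exp (ε * t) := by
  set q : ℝ := |p| + 1 with hq
  have hq0 : 0 < q := by positivity
  have hpq : p ≤ q := by linarith [le_abs_self p]
  refine ⟨Real.exp (ε - q - q * Real.log (ε / q)), fun t ht => ?_⟩
  have h1 : (0 : ℝ) < 1 + t := by linarith
  calc (1 + t) ^ p ≤ (1 + t) ^ q := Real.rpow_le_rpow_of_exponent_le (by linarith) hpq
    _ = Real.exp (Real.log (1 + t) * q) := Real.rpow_def_of_pos h1 q
    _ ≤ Real.exp ((ε - q - q * Real.log (ε / q)) + ε * t) := by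
        apply Real.exp_le_exp.2
        have hd : 0 < ε / q := by positivity
        have h2 := Real.log_le_sub_one_of_pos (mul_pos hd h1)
        rw [Real.log_mul hd.ne' h1.ne'] at h2
        have h3 := mul_le_mul_of_nonneg_right h2 hq0.le
        have h4 : (ε / q * (1 + t) - 1) * q = ε * (1 + t) - q := by field_simp
        nlinarith
    _ = _ := Real.exp_add _ _

lemma integrableOn_exp_mul_rpow_mul_one_add_rpow {a z : ℝ} (p : ℝ) (ha : 0 < a) (hz : 0 < z) :
    IntegrableOn (fun t : ℝ => Real.exp (-z * t) * t ^ (a - 1) * (1 + t) ^ p) (Ioi 0) := by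
  obtain ⟨C, hC⟩ := exists_one_add_rpow_le_mul_exp p (half_pos hz)
  have hdom : IntegrableOn (fun t : ℝ => C * (t ^ (a - 1) * Real.exp (-(z / 2) * t ^ (1 : ℝ))))
      (Ioi 0) :=
    (integrableOn_rpow_mul_exp_neg_mul_rpow (by linarith) one_pos (half_pos hz)).const_mul C
  refine hdom.mono' (Measurable.aestronglyMeasurable (by fun_prop)) ?_
  filter_upwards [ae_restrict_mem measurableSet_Ioi] with t ht
  have ht0 : 0 < t := ht
  rw [Real.norm_of_nonneg (by positivity), Real.rpow_one]
  calc Real.exp (-z * t) * t ^ (a - 1) * (1 + t) ^ p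
      ≤ Real.exp (-z * t) * t ^ (a - 1) * (C * Real.exp (z / 2 * t)) := by
        gcongr
        exact hC t ht0
    _ = C * (t ^ (a - 1) * (Real.exp (-z * t) * Real.exp (z / 2 * t))) := by ring
    _ = _ := by rw [← Real.exp_add]; ring_nf

lemma setIntegral_Ioi_pos_of_pos_of_ne {f : ℝ → ℝ} (s₀ : ℝ) (hf : IntegrableOn f (Ioi 0))
    (h0 : ∀ s, 0 < s → 0 ≤ f s) (hpos : ∀ s, 0 < s → s ≠ s₀ → 0 < f s) :
    0 < ∫ s in Ioi (0 : ℝ), f s := by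
  rw [setIntegral_pos_iff_support_of_nonneg_ae _ hf]
  · have hsub : Ioi (max 0 s₀) ⊆ Function.support f ∩ Ioi 0 := fun s hs => by
      obtain ⟨h1, h2⟩ := max_lt_iff.1 (mem_Ioi.1 hs)
      exact ⟨(hpos s h1 h2.ne').ne', h1⟩
    exact lt_of_lt_of_le (by simp) (measure_mono hsub)
  · filter_upwards [ae_restrict_mem measurableSet_Ioi] with s hs using h0 s hs

/-- If the quotient `h` of two densities `g * h` and `g` is strictly increasing, then the quotient
of their Laplace transforms is strictly decreasing (in cross-multiplied form). -/
lemma laplace_mul_lt_of_strictMonoOn {g h : ℝ → ℝ} {z₁ z₂ : ℝ} (hz : z₁ < z₂)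
    (hg : ∀ s, 0 < s → 0 < g s) (hh : StrictMonoOn h (Ioi 0))
    (hg₁ : IntegrableOn (fun s => Real.exp (-z₁ * s) * g s) (Ioi 0))
    (hg₂ : IntegrableOn (fun s => Real.exp (-z₂ * s) * g s) (Ioi 0))
    (hgh₁ : IntegrableOn (fun s => Real.exp (-z₁ * s) * (g s * h s)) (Ioi 0))
    (hgh₂ : IntegrableOn (fun s => Real.exp (-z₂ * s) * (g s * h s)) (Ioi 0)) :
    (∫ s in Ioi (0 : ℝ), Real.exp (-z₂ * s) * (g s * h s)) *
        (∫ s in Ioi (0 : ℝ), Real.exp (-z₁ * s) * g s) <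
      (∫ s in Ioi (0 : ℝ), Real.exp (-z₁ * s) * (g s * h s)) *
        (∫ s in Ioi (0 : ℝ), Real.exp (-z₂ * s) * g s) := by
  set A₁ := ∫ s in Ioi (0 : ℝ), Real.exp (-z₁ * s) * (g s * h s)
  set A₂ := ∫ s in Ioi (0 : ℝ), Real.exp (-z₂ * s) * (g s * h s)
  set B₁ := ∫ s in Ioi (0 : ℝ), Real.exp (-z₁ * s) * g s with hB₁
  set B₂ := ∫ s in Ioi (0 : ℝ), Real.exp (-z₂ * s) * g s with hB₂
  have hpos : ∀ s, 0 < s → 0 < Real.exp (-z₂ * s) * g s := fun s hs =>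
    mul_pos (Real.exp_pos _) (hg s hs)
  have hB₂0 : 0 < B₂ :=
    setIntegral_Ioi_pos_of_pos_of_ne 0 hg₂ (fun s hs => (hpos s hs).le) fun s hs _ => hpos s hs
  have hdiff : ∀ s, 0 < s → 0 < Real.exp (-z₁ * s) * g s - Real.exp (-z₂ * s) * g s := by
    intro s hs
    rw [← sub_mul]
    exact mul_pos (sub_pos.2 (Real.exp_lt_exp.2 (by nlinarith))) (hg s hs)
  have hB : B₂ < B₁ := by
    rw [← sub_pos, hB₁, hB₂, ← integral_sub hg₁ hg₂]
    exact setIntegral_Ioi_pos_of_pos_of_ne 0 (hg₁.sub hg₂) (fun s hs => (hdiff s hs).le)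
      fun s hs _ => hdiff s hs
  set m := B₁ / B₂ with hm
  have hm1 : 1 < m := (one_lt_div hB₂0).2 hB
  have hmB : m * B₂ = B₁ := div_mul_cancel₀ _ hB₂0.ne'
  have hd : 0 < z₂ - z₁ := sub_pos.2 hz
  -- The two exponentials `exp (-z₁ s)` and `m * exp (-z₂ s)` cross exactly at `s₀`.
  set s₀ := Real.log m / (z₂ - z₁) with hs₀
  have hs₀0 : 0 < s₀ := div_pos (Real.log_pos hm1) hd
  have hmexp : m = Real.exp ((z₂ - z₁) * s₀) := by
    rw [hs₀, mul_div_cancel₀ _ hd.ne', Real.exp_log (by linarith)]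
  have hfac : ∀ s, Real.exp (-z₁ * s) - m * Real.exp (-z₂ * s) =
      Real.exp (-z₂ * s) * (Real.exp ((z₂ - z₁) * s) - Real.exp ((z₂ - z₁) * s₀)) := by
    intro s
    rw [mul_sub, ← Real.exp_add, ← hmexp]
    ring_nf
  have hJ : IntegrableOn (fun s => Real.exp (-z₁ * s) * (g s * h s) -
      m * (Real.exp (-z₂ * s) * (g s * h s))) (Ioi 0) := hgh₁.sub (hgh₂.const_mul m)
  have hK : IntegrableOn (fun s => h s₀ * (Real.exp (-z₁ * s) * g s -
      m * (Real.exp (-z₂ * s) * g s))) (Ioi 0) := (hg₁.sub (hg₂.const_mul m)).const_mul (h s₀)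
  have hform : ∀ s, (Real.exp (-z₁ * s) * (g s * h s) -
      m * (Real.exp (-z₂ * s) * (g s * h s))) - h s₀ * (Real.exp (-z₁ * s) * g s -
      m * (Real.exp (-z₂ * s) * g s)) = Real.exp (-z₂ * s) * g s *
        ((Real.exp ((z₂ - z₁) * s) - Real.exp ((z₂ - z₁) * s₀)) * (h s - h s₀)) := by
    intro s
    linear_combination (g s * (h s - h s₀)) * hfac s
  have hIpos : ∀ s, 0 < s → s ≠ s₀ → 0 < (Real.exp (-z₁ * s) * (g s * h s) -
      m * (Real.exp (-z₂ * s) * (g s * h s))) - h s₀ * (Real.exp (-z₁ * s) * g s -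
      m * (Real.exp (-z₂ * s) * g s)) := by
    intro s hs hne
    rw [hform]
    refine mul_pos (hpos s hs) ?_
    rcases lt_or_gt_of_ne hne with hlt | hgt
    · exact mul_pos_of_neg_of_neg (sub_neg.2 (Real.exp_lt_exp.2 (by nlinarith)))
        (sub_neg.2 (hh hs hs₀0 hlt))
    · exact mul_pos (sub_pos.2 (Real.exp_lt_exp.2 (by nlinarith))) (sub_pos.2 (hh hs₀0 hs hgt))
  have hint := setIntegral_Ioi_pos_of_pos_of_ne s₀ (hJ.sub hK) (fun s hs => by
    rcases eq_or_ne s s₀ with rfl | hne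
    · rw [Pi.sub_apply, hform]; simp
    · exact (hIpos s hs hne).le) hIpos
  simp only [Pi.sub_apply] at hint
  rw [integral_sub hJ hK, integral_const_mul, integral_sub hgh₁ (hgh₂.const_mul m),
    integral_sub hg₁ (hg₂.const_mul m), integral_const_mul, integral_const_mul] at hint
  have hkey : m * A₂ < A₁ := by
    have : B₁ - m * B₂ = 0 := by rw [hmB, sub_self]
    change 0 < (A₁ - m * A₂) - h s₀ * (B₁ - m * B₂) at hint
    rw [this] at hint
    linarith
  calc A₂ * B₁ = (m * A₂) * B₂ := by rw [← hmB]; ring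
    _ < A₁ * B₂ := mul_lt_mul_of_pos_right hkey hB₂0

lemma integrableOn_one_sub_sq_rpow {a : ℝ} (ha : 0 < a) :
    IntegrableOn (fun r : ℝ => (1 - r ^ 2) ^ (a - 1)) (Ioo (-1) 1) := by
  have hleft : IntegrableOn (fun r : ℝ => (1 - r) ^ (a - 1)) (Ioo (-1) 1) := by
    have h := (intervalIntegral.intervalIntegrable_rpow' (a := 2) (b := 0)
      (show -1 < a - 1 by linarith)).comp_sub_left 1
    norm_num at h
    exact (intervalIntegrable_iff_integrableOn_Ioo_of_le (by norm_num)).1 h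
  have hright : IntegrableOn (fun r : ℝ => (1 + r) ^ (a - 1)) (Ioo (-1) 1) := by
    have h := (intervalIntegral.intervalIntegrable_rpow' (a := 0) (b := 2)
      (show -1 < a - 1 by linarith)).comp_add_left 1
    norm_num at h
    exact (intervalIntegrable_iff_integrableOn_Ioo_of_le (by norm_num)).1 h
  have hone : IntegrableOn (fun _ : ℝ => (1 : ℝ)) (Ioo (-1) 1) := by simp
  refine ((hleft.add hright).add hone).mono' (Measurable.aestronglyMeasurable (by fun_prop)) ?_
  filter_upwards [ae_restrict_mem measurableSet_Ioo] with r hr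
  have h1 : 0 < 1 - r := by linarith [hr.2]
  have h2 : 0 < 1 + r := by linarith [hr.1]
  have h3 : 1 - r ^ 2 = (1 - r) * (1 + r) := by ring
  have hp1 : 0 < (1 - r) ^ (a - 1) := Real.rpow_pos_of_pos h1 _
  have hp2 : 0 < (1 + r) ^ (a - 1) := Real.rpow_pos_of_pos h2 _
  have h4 : 0 < 1 - r ^ 2 := by rw [h3]; positivity
  rw [Real.norm_of_nonneg (Real.rpow_pos_of_pos h4 _).le]
  simp only [Pi.add_apply]
  rcases le_total 1 a with h | h
  · have := Real.rpow_le_one h4.le (by nlinarith : 1 - r ^ 2 ≤ 1) (by linarith : 0 ≤ a - 1)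
    linarith
  · rw [h3, Real.mul_rpow h1.le h2.le]
    rcases le_total 0 r with hr0 | hr0
    · have := Real.rpow_le_one_of_one_le_of_nonpos (by linarith : 1 ≤ 1 + r)
        (by linarith : a - 1 ≤ 0)
      nlinarith
    · have := Real.rpow_le_one_of_one_le_of_nonpos (by linarith : 1 ≤ 1 - r)
        (by linarith : a - 1 ≤ 0)
      nlinarith

/-- The Euler-type integral `∫ (1 - r²)^(a-1) (1 - (1 - r²) x²)^(1/2-c) dr` over `(-1, 1)`. -/
noncomputable def eulerIntegral (a c x : ℝ) : ℝ :=
  ∫ r in Ioo (-1 : ℝ) 1, (1 - r ^ 2) ^ (a - 1) * (1 - (1 - r ^ 2) * x ^ 2) ^ (1 / 2 - c)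

lemma one_sub_sq_mem_Ioc {r : ℝ} (hr : r ∈ Ioo (-1 : ℝ) 1) : 1 - r ^ 2 ∈ Ioc (0 : ℝ) 1 :=
  ⟨by nlinarith [hr.1, hr.2], by nlinarith [sq_nonneg r]⟩

lemma one_sub_mul_sq_pos {y x : ℝ} (hy : y ∈ Ioc (0 : ℝ) 1) (hx : x ∈ Ico (0 : ℝ) 1) :
    0 < 1 - y * x ^ 2 := by
  have h1 : x ^ 2 < 1 := by nlinarith [hx.1, hx.2]
  nlinarith [hy.1, hy.2, sq_nonneg x]

lemma integrableOn_eulerIntegrand {a c x : ℝ} (ha : 0 < a) (hc : 1 / 2 ≤ c)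
    (hx : x ∈ Ico (0 : ℝ) 1) :
    IntegrableOn (fun r : ℝ => (1 - r ^ 2) ^ (a - 1) * (1 - (1 - r ^ 2) * x ^ 2) ^ (1 / 2 - c))
      (Ioo (-1) 1) := by
  refine ((integrableOn_one_sub_sq_rpow ha).mul_const ((1 - 1 * x ^ 2) ^ (1 / 2 - c))).mono'
    (Measurable.aestronglyMeasurable (by fun_prop)) ?_
  filter_upwards [ae_restrict_mem measurableSet_Ioo] with r hr
  have hy := one_sub_sq_mem_Ioc hr
  have h1 := one_sub_mul_sq_pos hy hx
  have h2 := one_sub_mul_sq_pos ⟨one_pos, le_refl (1 : ℝ)⟩ hx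
  have h0 := hy.1
  rw [Real.norm_of_nonneg (by positivity)]
  refine mul_le_mul_of_nonneg_left ?_ (by positivity)
  exact Real.rpow_le_rpow_of_nonpos h2 (by nlinarith [hy.2, sq_nonneg x]) (by linarith)

lemma eulerIntegral_pos {a c x : ℝ} (ha : 0 < a) (hc : 1 / 2 ≤ c) (hx : x ∈ Ico (0 : ℝ) 1) :
    0 < eulerIntegral a c x := by
  have hpos : ∀ r ∈ Ioo (-1 : ℝ) 1,
      0 < (1 - r ^ 2) ^ (a - 1) * (1 - (1 - r ^ 2) * x ^ 2) ^ (1 / 2 - c) := fun r hr =>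
    mul_pos (Real.rpow_pos_of_pos (one_sub_sq_mem_Ioc hr).1 _)
      (Real.rpow_pos_of_pos (one_sub_mul_sq_pos (one_sub_sq_mem_Ioc hr) hx) _)
  rw [eulerIntegral,
    setIntegral_pos_iff_support_of_nonneg_ae _ (integrableOn_eulerIntegrand ha hc hx)]
  · refine lt_of_lt_of_le ?_ (measure_mono fun r hr => ⟨(hpos r hr).ne', hr⟩)
    simp
  · filter_upwards [ae_restrict_mem measurableSet_Ioo] with r hr using (hpos r hr).le

lemma eulerIntegral_monotoneOn {a c : ℝ} (ha : 0 < a) (hc : 1 / 2 ≤ c) :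
    MonotoneOn (eulerIntegral a c) (Ico 0 1) := by
  intro x hx y hy hxy
  refine setIntegral_mono_on (integrableOn_eulerIntegrand ha hc hx)
    (integrableOn_eulerIntegrand ha hc hy) measurableSet_Ioo fun r hr => ?_
  have h0 := one_sub_sq_mem_Ioc hr
  have hsq : x ^ 2 ≤ y ^ 2 := pow_le_pow_left₀ hx.1 hxy 2
  refine mul_le_mul_of_nonneg_left ?_ (Real.rpow_pos_of_pos h0.1 _).le
  exact Real.rpow_le_rpow_of_nonpos (one_sub_mul_sq_pos h0 hy) (by nlinarith [h0.1]) (by linarith)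

/-- The quotient of the density of `Γ(a)² Ψ(a,c,·)²` by that of `Γ(2a) Ψ(2a,c,·)`, both viewed as
Laplace transforms. -/
noncomputable def densityRatio (a c s : ℝ) : ℝ :=
  2 * ((1 + s) / (2 + s)) ^ (2 * a) * eulerIntegral a c (s / (2 + s))

lemma densityRatio_strictMonoOn {a c : ℝ} (ha : 0 < a) (hc : 1 / 2 ≤ c) :
    StrictMonoOn (densityRatio a c) (Ioi 0) := by
  have hmem : ∀ {s : ℝ}, 0 < s → s / (2 + s) ∈ Ico (0 : ℝ) 1 := fun {s} hs =>
    ⟨by positivity, (div_lt_one (by positivity)).2 (by linarith)⟩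
  intro s hs t ht hst
  have hs0 : 0 < s := hs
  have ht0 : 0 < t := ht
  have h1 : ((1 + s) / (2 + s)) ^ (2 * a) < ((1 + t) / (2 + t)) ^ (2 * a) := by
    refine Real.rpow_lt_rpow (by positivity) ?_ (by positivity)
    rw [div_lt_div_iff₀ (by positivity) (by positivity)]
    nlinarith
  have h2 : eulerIntegral a c (s / (2 + s)) ≤ eulerIntegral a c (t / (2 + t)) := by
    refine eulerIntegral_monotoneOn ha hc (hmem hs0) (hmem ht0) ?_
    rw [div_le_div_iff₀ (by positivity) (by positivity)]
    nlinarith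
  have h3 := eulerIntegral_pos ha hc (hmem hs0)
  refine mul_lt_mul (by linarith) h2 h3 (by positivity)

/-- The increasing substitution `(-1, 1) → (0, s)` that brings the self-convolution integral into
Euler form. -/
noncomputable def eulerSubst (s r : ℝ) : ℝ :=
  s / 2 * (1 + r * (2 + s) / √(4 * (1 + s) + s ^ 2 * r ^ 2))

lemma hasDerivAt_eulerSubst {s : ℝ} (hs : 0 < s) (r : ℝ) :
    HasDerivAt (eulerSubst s) (2 * s * (2 + s) * (1 + s) /
      ((4 * (1 + s) + s ^ 2 * r ^ 2) * √(4 * (1 + s) + s ^ 2 * r ^ 2))) r := by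
  have hQ : 0 < 4 * (1 + s) + s ^ 2 * r ^ 2 := by positivity
  have hsq : 0 < √(4 * (1 + s) + s ^ 2 * r ^ 2) := Real.sqrt_pos.2 hQ
  have hdQ : HasDerivAt (fun r : ℝ => 4 * (1 + s) + s ^ 2 * r ^ 2) (s ^ 2 * (2 * r)) r := by
    simpa using ((hasDerivAt_pow 2 r).const_mul (s ^ 2)).const_add (4 * (1 + s))
  have hnum : HasDerivAt (fun r : ℝ => r * (2 + s)) (2 + s) r := by
    simpa using (hasDerivAt_id r).mul_const (2 + s)
  have h := ((hnum.div (hdQ.sqrt hQ.ne') hsq.ne').const_add 1).const_mul (s / 2)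
  refine h.congr_deriv ?_
  have hss : √(4 * (1 + s) + s ^ 2 * r ^ 2) ^ 2 = 4 * (1 + s) + s ^ 2 * r ^ 2 :=
    Real.sq_sqrt hQ.le
  generalize √(4 * (1 + s) + s ^ 2 * r ^ 2) = w at *
  rw [← hss]
  field_simp
  rw [hss]
  ring

lemma eulerSubst_strictMono {s : ℝ} (hs : 0 < s) : StrictMono (eulerSubst s) :=
  strictMono_of_hasDerivAt_pos (fun r => hasDerivAt_eulerSubst hs r) fun r => by positivity

lemma eulerSubst_image {s : ℝ} (hs : 0 < s) : eulerSubst s '' Ioo (-1) 1 = Ioo 0 s := by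
  have hroot : √(4 * (1 + s) + s ^ 2) = 2 + s := by
    rw [show 4 * (1 + s) + s ^ 2 = (2 + s) ^ 2 by ring, Real.sqrt_sq (by positivity)]
  have hne : 2 + s ≠ 0 := by positivity
  have h1 : eulerSubst s (-1) = 0 := by
    simp only [eulerSubst, neg_one_sq, mul_one, hroot, neg_one_mul, neg_div, div_self hne]
    ring
  have h2 : eulerSubst s 1 = s := by
    simp only [eulerSubst, one_pow, mul_one, hroot, one_mul, div_self hne]
    ring
  refine Subset.antisymm ?_ ?_
  · rintro _ ⟨r, hr, rfl⟩
    exact ⟨h1 ▸ eulerSubst_strictMono hs hr.1, (eulerSubst_strictMono hs hr.2).trans_eq h2⟩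
  · have hcont : ContinuousOn (eulerSubst s) (Icc (-1) 1) := fun r _ =>
      (hasDerivAt_eulerSubst hs r).continuousAt.continuousWithinAt
    have h := intermediate_value_Ioo (by norm_num : (-1 : ℝ) ≤ 1) hcont
    rwa [h1, h2] at h

lemma eulerSubst_mul_sub {s : ℝ} (hs : 0 < s) (r : ℝ) :
    eulerSubst s r * (s - eulerSubst s r) =
      s ^ 2 * (1 + s) * (1 - r ^ 2) / (4 * (1 + s) + s ^ 2 * r ^ 2) := by
  have hQ : 0 < 4 * (1 + s) + s ^ 2 * r ^ 2 := by positivity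
  have hsq : 0 < √(4 * (1 + s) + s ^ 2 * r ^ 2) := Real.sqrt_pos.2 hQ
  have hss : √(4 * (1 + s) + s ^ 2 * r ^ 2) ^ 2 = 4 * (1 + s) + s ^ 2 * r ^ 2 :=
    Real.sq_sqrt hQ.le
  unfold eulerSubst
  generalize √(4 * (1 + s) + s ^ 2 * r ^ 2) = w at *
  rw [← hss]
  field_simp
  linear_combination hss

/-- Bookkeeping of exponents for the substitution `eulerSubst`. -/
lemma eulerSubst_integrand_eq (a c : ℝ) {s A B Y Q : ℝ} (hs : 0 < s) (hA : 0 < A) (hB : 0 < B)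
    (hY : 0 < Y) (hQ : 0 < Q) :
    2 * s * B * A / (Q * √Q) *
        ((s ^ 2 * A * Y / Q) ^ (a - 1) * (A * B ^ 2 / Q) ^ (c - a - 1)) =
      s ^ (2 * a - 1) * A ^ (c - 2 * a - 1) * (2 * (A / B) ^ (2 * a)) *
        (Y ^ (a - 1) * (Q / B ^ 2) ^ (1 / 2 - c)) := by
  have hlog : ∀ {x y : ℝ}, 0 < x → 0 < y → Real.log (x * y) = Real.log x + Real.log y :=
    fun hx hy => Real.log_mul hx.ne' hy.ne'
  have hlogd : ∀ {x y : ℝ}, 0 < x → 0 < y → Real.log (x / y) = Real.log x - Real.log y :=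
    fun hx hy => Real.log_div hx.ne' hy.ne'
  have hlogr : ∀ {x : ℝ} (y : ℝ), 0 < x → Real.log (x ^ y) = y * Real.log x :=
    fun y hx => Real.log_rpow hx y
  refine Real.log_injOn_pos (mem_Ioi.2 (by positivity)) (mem_Ioi.2 (by positivity)) ?_
  have hsq : 0 < √Q := Real.sqrt_pos.2 hQ
  simp (disch := positivity) only [hlog, hlogd, hlogr, Real.log_pow, Real.log_sqrt]
  push_cast
  ring

lemma integral_selfConvolution_eq (a c : ℝ) {s : ℝ} (hs : 0 < s) :
    ∫ u in (0 : ℝ)..s, (u ^ (a - 1) * (1 + u) ^ (c - a - 1)) *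
        ((s - u) ^ (a - 1) * (1 + (s - u)) ^ (c - a - 1)) =
      s ^ (2 * a - 1) * (1 + s) ^ (c - 2 * a - 1) * densityRatio a c s := by
  rw [intervalIntegral.integral_of_le hs.le, integral_Ioc_eq_integral_Ioo, ← eulerSubst_image hs,
    integral_image_eq_integral_deriv_smul_of_monotoneOn measurableSet_Ioo
      (fun r _ => (hasDerivAt_eulerSubst hs r).hasDerivWithinAt)
      ((eulerSubst_strictMono hs).monotone.monotoneOn _),
    densityRatio, eulerIntegral, ← mul_assoc, ← integral_const_mul]
  refine setIntegral_congr_fun measurableSet_Ioo fun r hr => ?_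
  have hu : eulerSubst s r ∈ Ioo 0 s := eulerSubst_image hs ▸ mem_image_of_mem _ hr
  have hY := (one_sub_sq_mem_Ioc hr).1
  have hQ : 0 < 4 * (1 + s) + s ^ 2 * r ^ 2 := by positivity
  have hprod := eulerSubst_mul_sub hs r
  have hu1 := hu.1
  have hu2 : 0 < s - eulerSubst s r := sub_pos.2 hu.2
  have hprod' : (1 + eulerSubst s r) * (1 + (s - eulerSubst s r)) =
      (1 + s) * (2 + s) ^ 2 / (4 * (1 + s) + s ^ 2 * r ^ 2) := by
    rw [show (1 + eulerSubst s r) * (1 + (s - eulerSubst s r)) =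
      1 + s + eulerSubst s r * (s - eulerSubst s r) by ring, hprod]
    field_simp
    ring
  have hbase : 1 - (1 - r ^ 2) * (s / (2 + s)) ^ 2 =
      (4 * (1 + s) + s ^ 2 * r ^ 2) / (2 + s) ^ 2 := by
    field_simp
    ring
  simp only [smul_eq_mul]
  rw [hbase, ← eulerSubst_integrand_eq a c hs (by positivity) (by positivity) hY hQ, ← hprod,
    ← hprod', Real.mul_rpow hu1.le hu2.le, Real.mul_rpow (by positivity) (by positivity)]
  ring

lemma exp_mul_selfConvolution_eq (a c z : ℝ) {s : ℝ} (hs : 0 < s) :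
    ∫ u in (0 : ℝ)..s, (Real.exp (-z * u) * u ^ (a - 1) * (1 + u) ^ (c - a - 1)) *
        (Real.exp (-z * (s - u)) * (s - u) ^ (a - 1) * (1 + (s - u)) ^ (c - a - 1)) =
      Real.exp (-z * s) *
        (s ^ (2 * a - 1) * (1 + s) ^ (c - 2 * a - 1) * densityRatio a c s) := by
  rw [← integral_selfConvolution_eq a c hs, ← intervalIntegral.integral_const_mul]
  refine intervalIntegral.integral_congr fun u _ => ?_
  have hexp : Real.exp (-z * s) = Real.exp (-z * u) * Real.exp (-z * (s - u)) := by
    rw [← Real.exp_add]; ring_nf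
  simp only [hexp]
  ring

lemma integrableOn_exp_mul_densityRatio {a z : ℝ} (c : ℝ) (ha : 0 < a) (hz : 0 < z) :
    IntegrableOn (fun s : ℝ => Real.exp (-z * s) *
      (s ^ (2 * a - 1) * (1 + s) ^ (c - 2 * a - 1) * densityRatio a c s)) (Ioi 0) := by
  have hf := integrableOn_exp_mul_rpow_mul_one_add_rpow (c - a - 1) ha hz
  have h := (integrable_posConvolution hf hf (ContinuousLinearMap.mul ℝ ℝ)).integrableOn
    (s := Ioi 0)
  refine h.congr_fun (fun s hs => ?_) measurableSet_Ioi
  rw [posConvolution, indicator_of_mem hs]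
  exact exp_mul_selfConvolution_eq a c z hs

lemma integral_exp_mul_densityRatio {a z : ℝ} (c : ℝ) (ha : 0 < a) (hz : 0 < z) :
    ∫ s in Ioi (0 : ℝ), Real.exp (-z * s) *
        (s ^ (2 * a - 1) * (1 + s) ^ (c - 2 * a - 1) * densityRatio a c s) =
      (Real.Gamma a * Psi a c z) ^ 2 := by
  have hf := integrableOn_exp_mul_rpow_mul_one_add_rpow (c - a - 1) ha hz
  have h := integral_posConvolution hf hf (ContinuousLinearMap.mul ℝ ℝ)
  have hΓ := (Real.Gamma_pos_of_pos ha).ne'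
  rw [Psi, ← mul_assoc, mul_one_div_cancel hΓ, one_mul, sq]
  refine Eq.trans ?_ h
  exact setIntegral_congr_fun measurableSet_Ioi fun s hs =>
    (exp_mul_selfConvolution_eq a c z hs).symm

/-- Corollary: for `a > 0` and `c ∈ [1/2,1]`, the function `z ↦ Ψ(a,c,z)²/Ψ(2a,c,z)`
is strictly decreasing on `(0,∞)`. -/
theorem Psi_sq_ratio_strictAnti (a c : ℝ) (ha : 0 < a) (hc1 : 1 / 2 ≤ c) (hc2 : c ≤ 1) :
    StrictAntiOn (fun z => (Psi a c z) ^ 2 / Psi (2 * a) c z) (Ioi (0 : ℝ)) := by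
  have h2a : 0 < 2 * a := by positivity
  have hΓ : 0 < Real.Gamma a := Real.Gamma_pos_of_pos ha
  have hΓ2 : 0 < Real.Gamma (2 * a) := Real.Gamma_pos_of_pos h2a
  set g : ℝ → ℝ := fun s => s ^ (2 * a - 1) * (1 + s) ^ (c - 2 * a - 1) with hgdef
  have hgpos : ∀ s, 0 < s → 0 < g s := fun s hs => by positivity
  have hgint : ∀ z, 0 < z → IntegrableOn (fun s => Real.exp (-z * s) * g s) (Ioi 0) :=
    fun z hz => by
      simpa only [hgdef, mul_assoc] using
        integrableOn_exp_mul_rpow_mul_one_add_rpow (c - 2 * a - 1) h2a hz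
  have hB : ∀ z, ∫ s in Ioi (0 : ℝ), Real.exp (-z * s) * g s =
      Real.Gamma (2 * a) * Psi (2 * a) c z := fun z => by
    rw [Psi, ← mul_assoc, mul_one_div_cancel hΓ2.ne', one_mul]
    simp only [hgdef, mul_assoc]
  have hPsi : ∀ z, 0 < z → 0 < Psi (2 * a) c z := fun z hz => by
    have hpos : ∀ s, 0 < s → 0 < Real.exp (-z * s) * g s := fun s hs =>
      mul_pos (Real.exp_pos _) (hgpos s hs)
    have h := setIntegral_Ioi_pos_of_pos_of_ne 0 (hgint z hz) (fun s hs => (hpos s hs).le)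
      fun s hs _ => hpos s hs
    rw [hB] at h
    exact pos_of_mul_pos_right h hΓ2.le
  intro z₁ hz₁ z₂ hz₂ hz
  have h := laplace_mul_lt_of_strictMonoOn hz hgpos (densityRatio_strictMonoOn ha hc1)
    (hgint z₁ hz₁) (hgint z₂ hz₂) (integrableOn_exp_mul_densityRatio c ha hz₁)
    (integrableOn_exp_mul_densityRatio c ha hz₂)
  rw [hB, hB, integral_exp_mul_densityRatio c ha hz₁, integral_exp_mul_densityRatio c ha hz₂] at h
  change Psi a c z₂ ^ 2 / Psi (2 * a) c z₂ < Psi a c z₁ ^ 2 / Psi (2 * a) c z₁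
  rw [div_lt_div_iff₀ (hPsi z₂ hz₂) (hPsi z₁ hz₁)]
  refine lt_of_mul_lt_mul_left ?_ (by positivity : 0 ≤ Real.Gamma a ^ 2 * Real.Gamma (2 * a))
  calc _ = (Real.Gamma a * Psi a c z₂) ^ 2 * (Real.Gamma (2 * a) * Psi (2 * a) c z₁) := by ring
    _ < _ := h
    _ = _ := by ring
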